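/- Assume (H1), (H2) and upper Ahlfors regularity (H4′). Let ω < t and 0 < λ ≤ λ₀. Let k ≥ 0 be an integer, 0 < δ ≤ η₁^k δ_Γ, and let Γ″ ⊆ A_{ω,δ} ∩ Γ_t be H^t-measurable. Let Tu : Γ″ → ℝ be H^t-measurable and such that for every x̄ ∈ Γ″, g(x;u) → Tu(x̄) as x → x̄ with x ∈ Q_{λ₀}(x̄). For 0 < ρ ≤ δ/(3C_Γ) define g_ρ(x̄) := ⨍_{Q_{λ,ρ}(x̄)∖B(x̄,η₁ρ)} g(x;u) dx. Then ( ∫_{Γ″} |Tu(x̄) − g_ρ(x̄)|ᵖ dH^t(x̄) )^{1/p} ≤ C₁ · η₁^{k(t−ω)/p} · ν(B_{2η₁^kδ_Γ}(Γ″); u)^{1/p}, where C₁ := c · ε_{λ′}^{−(n+p)/p} · (1 − η₁^{(t−ω)/p})^{−1} with λ′ := η₁²λ, B_r(E) := { x : dist(x,E) < r }, and c a constant depending only on n, t, p, A_Γ, C_Γ, δ_Γ and ω. -/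

import Mathlib

open MeasureTheory Metric Set Filter
open scoped ENNReal NNReal Topology

noncomputable section

abbrev Euc (n : ℕ) := EuclideanSpace ℝ (Fin n)

variable {n : ℕ}

/-- Distance to the boundary of `Ω`. -/
def dB (Ω : Set (Euc n)) (x : Euc n) : ℝ := infDist x (frontier Ω)

/-- `Ψ(x) = B(x, d(x)/2)`. -/
def PsiB (Ω : Set (Euc n)) (x : Euc n) : Set (Euc n) := ball x (dB Ω x / 2)

/-- `Φ(x) = B(x, d(x)/6)`. -/
def PhiB (Ω : Set (Euc n)) (x : Euc n) : Set (Euc n) := ball x (dB Ω x / 6)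

/-- The integrand of `ν(·;u)`. -/
def nuInt (Ω : Set (Euc n)) (s : Euc n → ℝ) (p : ℝ) (u : Euc n → ℝ) (x : Euc n) : ℝ :=
  (⨍ y in PsiB Ω x, |u y - u x|) ^ p * dB Ω x ^ (-(p * s x))

/-- `ν(E;u)`. -/
def nuM (Ω : Set (Euc n)) (s : Euc n → ℝ) (p : ℝ) (u : Euc n → ℝ) (E : Set (Euc n)) : ℝ :=
  ∫ x in Ω ∩ E, nuInt Ω s p u x

/-- Membership in the nonlocal space `𝒩^{s,p}(Ω)`: `u ∈ L¹(Ω)` and `ν(Ω;u) < ∞`. -/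
def MemN (Ω : Set (Euc n)) (s : Euc n → ℝ) (p : ℝ) (u : Euc n → ℝ) : Prop :=
  IntegrableOn u Ω volume ∧ IntegrableOn (nuInt Ω s p u) Ω volume

/-- `g(x;u)`, the mean of `u` over `Φ(x)`. -/
def gFun (Ω : Set (Euc n)) (u : Euc n → ℝ) (x : Euc n) : ℝ := ⨍ y in PhiB Ω x, u y

/-- The approach region `Q^θ_λ(xb)`. -/
def Qreg (Ω : Set (Euc n)) (lam θ : ℝ) (xb : Euc n) : Set (Euc n) :=
  {x | x ∈ Ω ∧ (lam * dist xb x) ^ θ < dB Ω x}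

/-- `Q` is an `(η,θ)`-corkscrew region for `xb` with radius `δ₀`. -/
def IsCorkscrew (Ω Q : Set (Euc n)) (xb : Euc n) (η θ δ₀ : ℝ) : Prop :=
  ∀ δ : ℝ, 0 < δ → δ ≤ δ₀ →
    ∃ x ∈ Q, η * δ < dist xb x ∧ dist xb x < δ ∧ (η * δ) ^ θ < dB Ω x

/-- `E` is `(C,θ)`-connected to `xb`, with radius `ρ₀` and gauge `ε`. -/
def ConnectedTo (Ω E : Set (Euc n)) (xb : Euc n) (C θ ρ₀ : ℝ) (ε : ℝ → ℝ) : Prop :=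
  ∀ lam : ℝ, 0 < lam → lam < 1 →
    0 < ε lam ∧ ε lam ≤ lam ∧
      ∀ ρ : ℝ, 0 < ρ → ρ ≤ ρ₀ → ∀ x ∈ E ∩ ball xb ρ, ∀ x' ∈ E ∩ ball xb ρ,
        (lam * ρ) ^ θ ≤ dB Ω x → (lam * ρ) ^ θ ≤ dB Ω x' →
        ∃ γ : ℝ → Euc n, ContinuousOn γ (Icc 0 1) ∧ γ 0 = x ∧ γ 1 = x' ∧
          (∀ τ ∈ Icc (0:ℝ) 1, γ τ ∈ E ∧ ε lam * ρ ^ θ ≤ dB Ω (γ τ)) ∧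
          eVariationOn γ (Icc 0 1) ≤ ENNReal.ofReal (C * ρ)

/-- The piecewise bilinear function `α(s,θ)`. -/
def alphaFun (n : ℕ) (p sv θ : ℝ) : ℝ :=
  if p * sv - n ≤ p - 1 then p * (1 - θ) + (p * sv - n) * θ
  else (1 - θ) + (p * sv - n)

/-- `s̲_δ(xb)`. -/
def sLow (Ω : Set (Euc n)) (s : Euc n → ℝ) (xb : Euc n) (δ : ℝ) : ℝ :=
  sInf (s '' (Ω ∩ ball xb δ))

/-- `α̲_δ(xb)`. -/
def alphaLow (Ω : Set (Euc n)) (s : Euc n → ℝ) (p : ℝ) (θΓ : Euc n → ℝ)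
    (xb : Euc n) (δ : ℝ) : ℝ :=
  alphaFun n p (sLow Ω s xb δ) (θΓ xb)

/-- `α̲_0(xb) = lim_{δ → 0⁺} α̲_δ(xb)`. -/
def alphaLow0 (Ω : Set (Euc n)) (s : Euc n → ℝ) (p : ℝ) (θΓ : Euc n → ℝ) (xb : Euc n) : ℝ :=
  limUnder (𝓝[>] (0:ℝ)) (fun δ => alphaLow Ω s p θΓ xb δ)

/-- `Γ_τ`: points of `Γ` where `limsup_{ρ→0⁺} ρ^{-τ} ν(B(xb,ρ);u) < ∞`. -/
def GammaTau (Ω : Set (Euc n)) (s : Euc n → ℝ) (p : ℝ) (u : Euc n → ℝ)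
    (Γ : Set (Euc n)) (τ : ℝ) : Set (Euc n) :=
  {xb ∈ Γ | ∃ M : ℝ, ∀ᶠ ρ in 𝓝[>] (0:ℝ), ρ ^ (-τ) * nuM Ω s p u (ball xb ρ) ≤ M}

/-- `M_τ(xb) = sup_{0<ρ≤δΓ} ρ^{-τ} ν(B(xb,ρ);u)`. -/
def Mtau (Ω : Set (Euc n)) (s : Euc n → ℝ) (p : ℝ) (u : Euc n → ℝ)
    (δΓ τ : ℝ) (xb : Euc n) : ℝ :=
  sSup ((fun ρ => ρ ^ (-τ) * nuM Ω s p u (ball xb ρ)) '' Ioc 0 δΓ)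

lemma dB_pos {Ω : Set (Euc n)} (hO : IsOpen Ω) (hF : (frontier Ω).Nonempty) {x : Euc n}
    (hx : x ∈ Ω) : 0 < dB Ω x := by
  unfold dB
  refine (isClosed_frontier.notMem_iff_infDist_pos hF).1 ?_
  intro h
  rw [hO.frontier_eq] at h
  exact h.2 hx

lemma dB_nonneg (Ω : Set (Euc n)) (x : Euc n) : 0 ≤ dB Ω x := infDist_nonneg

lemma dB_le_add (Ω : Set (Euc n)) (x y : Euc n) : dB Ω x ≤ dB Ω y + dist x y :=
  infDist_le_infDist_add_dist

lemma dB_le_dist {Ω : Set (Euc n)} {xb : Euc n} (h : xb ∈ frontier Ω) (x : Euc n) :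
    dB Ω x ≤ dist x xb := infDist_le_dist_of_mem h

lemma dB_cont (Ω : Set (Euc n)) : Continuous (dB Ω) := continuous_infDist_pt _

lemma ball_subO {Ω : Set (Euc n)} (hO : IsOpen Ω) {x : Euc n}
    (hx : x ∈ Ω) {r : ℝ} (hr : r ≤ dB Ω x) : ball x r ⊆ Ω := by
  rcases le_or_gt r 0 with h0 | h0
  · rw [ball_eq_empty.2 h0]; exact empty_subset _
  by_contra hcon
  have hpre : IsPreconnected (ball x r) := (convex_ball x r).isPreconnected
  obtain ⟨y, hy, hyn⟩ := not_subset.1 hcon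
  have : (ball x r ∩ frontier Ω).Nonempty := by
    by_contra hne
    rw [not_nonempty_iff_eq_empty] at hne
    have h1 : ball x r ⊆ Ω ∪ (closure Ω)ᶜ := by
      intro z hz
      by_contra hz'
      have : z ∈ ball x r ∩ frontier Ω := by
        refine ⟨hz, ?_⟩
        rw [hO.frontier_eq]
        simp only [mem_union, mem_compl_iff, not_or, not_not] at hz'
        exact ⟨hz'.2, hz'.1⟩
      rw [hne] at this
      exact this
    have h2 : y ∈ (closure Ω)ᶜ := (h1 hy).resolve_left hyn
    obtain ⟨z, hz, hz1, hz2⟩ := hpre Ω (closure Ω)ᶜ hO isClosed_closure.isOpen_compl h1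
      ⟨x, mem_ball_self h0, hx⟩ ⟨y, hy, h2⟩
    exact hz2 (subset_closure hz1)
  obtain ⟨z, hz, hzf⟩ := this
  have := dB_le_dist hzf x
  rw [mem_ball, dist_comm] at hz
  linarith

lemma volreal_ball (x : Euc n) {r : ℝ} (hr : 0 < r) :
    volume.real (ball x r) = r ^ n * volume.real (ball (0 : Euc n) 1) := by
  simp only [Measure.real]
  rw [Measure.addHaar_ball_of_pos _ _ hr, ENNReal.toReal_mul, ENNReal.toReal_ofReal (by positivity)]
  simp

lemma vol_unit_pos : 0 < volume.real (ball (0 : Euc n) 1) := by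
  refine ENNReal.toReal_pos (measure_ball_pos _ _ one_pos).ne' measure_ball_lt_top.ne

lemma gFun_meas {Ω : Set (Euc n)} (hO : IsOpen Ω)
    {u : Euc n → ℝ} (hu : IntegrableOn u Ω volume) :
    AEStronglyMeasurable (gFun Ω u) (volume.restrict Ω) := by
  have hm := hu.1
  set v := hm.mk u with hv
  have hvm : StronglyMeasurable v := hm.stronglyMeasurable_mk
  have hS : MeasurableSet {q : Euc n × Euc n | dist q.2 q.1 < dB Ω q.1 / 6} := by
    apply IsOpen.measurableSet
    apply isOpen_lt (by fun_prop)
    exact ((dB_cont Ω).comp continuous_fst).div_const _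
  have h1 : StronglyMeasurable (fun x => ∫ y,
      ({q : Euc n × Euc n | dist q.2 q.1 < dB Ω q.1 / 6}.indicator (fun q => v q.2)) (x, y)) := by
    apply StronglyMeasurable.integral_prod_right'
    exact (hvm.comp_measurable measurable_snd).indicator hS
  have h2 : Measurable (fun x : Euc n => volume
      (Prod.mk x ⁻¹' {q : Euc n × Euc n | dist q.2 q.1 < dB Ω q.1 / 6})) :=
    measurable_measure_prodMk_left hS
  refine ⟨fun x => (volume
      (Prod.mk x ⁻¹' {q : Euc n × Euc n | dist q.2 q.1 < dB Ω q.1 / 6})).toReal⁻¹ * ∫ y,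
      ({q : Euc n × Euc n | dist q.2 q.1 < dB Ω q.1 / 6}.indicator (fun q => v q.2)) (x, y),
      (h2.ennreal_toReal.inv.stronglyMeasurable).mul h1, ?_⟩
  filter_upwards [ae_restrict_mem hO.measurableSet] with x hx
  unfold gFun
  rw [setAverage_eq, smul_eq_mul]
  have e1 : Prod.mk x ⁻¹' {q : Euc n × Euc n | dist q.2 q.1 < dB Ω q.1 / 6} = PhiB Ω x := by
    ext y; simp [PhiB]
  rw [e1]
  congr 1
  have e2 : (fun y => ({q : Euc n × Euc n | dist q.2 q.1 < dB Ω q.1 / 6}.indicator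
      (fun q => v q.2)) (x, y)) = (PhiB Ω x).indicator v := by
    ext y; simp [PhiB, indicator]
  rw [e2, integral_indicator (by exact measurableSet_ball)]
  apply integral_congr_ae
  have hsub : PhiB Ω x ⊆ Ω := ball_subO hO hx (by have := dB_nonneg Ω x; linarith)
  exact ae_restrict_of_ae_restrict_of_subset hsub hm.ae_eq_mk

lemma nuInt_nonneg (Ω : Set (Euc n)) (s : Euc n → ℝ) (p : ℝ) (u : Euc n → ℝ) (x : Euc n) :
    0 ≤ nuInt Ω s p u x := by
  unfold nuInt
  refine mul_nonneg (Real.rpow_nonneg ?_ _) (Real.rpow_nonneg (dB_nonneg _ _) _)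
  rw [setAverage_eq]
  exact smul_nonneg (by positivity) (integral_nonneg fun _ => abs_nonneg _)

/-- Mean of a difference bounded by the mean of absolute value. -/
lemma local_osc {Ω : Set (Euc n)} (hO : IsOpen Ω) (hF : (frontier Ω).Nonempty)
    {u : Euc n → ℝ} (hu : IntegrableOn u Ω volume) {x x' y : Euc n}
    (hx : x ∈ Ω) (hd : dist x x' ≤ dB Ω x / 20) (hy : y ∈ PhiB Ω x) :
    |u y - gFun Ω u x'| ≤ 4 ^ n * ⨍ z in PsiB Ω y, |u z - u y| := by
  have dx := dB_pos hO hF hx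
  have hyO : y ∈ Ω := ball_subO hO hx (by linarith) hy
  have hx'O : x' ∈ Ω := by
    refine ball_subO hO hx le_rfl ?_
    rw [mem_ball, dist_comm]; linarith
  have dy := dB_pos hO hF hyO
  have dx' := dB_pos hO hF hx'O
  have hy1 : dist y x < dB Ω x / 6 := hy
  have a1 := dB_le_add Ω x y
  have a2 := dB_le_add Ω y x
  have a3 := dB_le_add Ω x x'
  have a4 := dB_le_add Ω x' x
  rw [dist_comm x y] at a1
  rw [dist_comm x' x] at a4
  have hPsiO : PsiB Ω y ⊆ Ω := ball_subO hO hyO (by linarith)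
  have hsub : PhiB Ω x' ⊆ PsiB Ω y := by
    apply ball_subset_ball'
    have : dist x' y ≤ dist x x' + dist y x := by
      rw [dist_comm x x', dist_comm y x]; exact dist_triangle _ _ _
    linarith
  have iPsi : IntegrableOn u (PsiB Ω y) volume := hu.mono_set hPsiO
  have fPsi : volume (PsiB Ω y) ≠ ⊤ := measure_ball_lt_top.ne
  have iPsi' : IntegrableOn (fun z => |u z - u y|) (PsiB Ω y) volume :=
    (iPsi.sub (integrableOn_const fPsi)).abs
  have fPhi : volume (PhiB Ω x') ≠ ⊤ := measure_ball_lt_top.ne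
  have iPhi := iPsi.mono_set hsub
  have vPhi : volume.real (PhiB Ω x') = (dB Ω x' / 6) ^ n * volume.real (ball (0 : Euc n) 1) :=
    volreal_ball _ (by linarith)
  have vPsi : volume.real (PsiB Ω y) = (dB Ω y / 2) ^ n * volume.real (ball (0 : Euc n) 1) :=
    volreal_ball _ (by linarith)
  have v0 := vol_unit_pos (n := n)
  have pPhi : 0 < volume.real (PhiB Ω x') := by rw [vPhi]; positivity
  have pPsi : 0 < volume.real (PsiB Ω y) := by rw [vPsi]; positivity
  have e : u y - gFun Ω u x' = (volume.real (PhiB Ω x'))⁻¹ * ∫ z in PhiB Ω x', (u y - u z) := by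
    have ic : IntegrableOn (fun _ : Euc n => u y) (PhiB Ω x') volume := integrableOn_const fPhi
    rw [integral_sub ic iPhi]
    unfold gFun
    rw [setAverage_eq, smul_eq_mul]
    simp only [integral_const, smul_eq_mul]
    simp only [measureReal_restrict_apply_univ]
    field_simp
  rw [e, abs_mul, abs_of_pos (inv_pos.2 pPhi), setAverage_eq, smul_eq_mul]
  have i1 : |∫ z in PhiB Ω x', (u y - u z)| ≤ ∫ z in PsiB Ω y, |u z - u y| := by
    calc |∫ z in PhiB Ω x', (u y - u z)| ≤ ∫ z in PhiB Ω x', |u y - u z| := abs_integral_le_integral_abs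
      _ = ∫ z in PhiB Ω x', |u z - u y| := by simp_rw [abs_sub_comm]
      _ ≤ _ := setIntegral_mono_set iPsi' (Eventually.of_forall fun _ => abs_nonneg _)
          (Eventually.of_forall hsub)
  have i2 : (volume.real (PhiB Ω x'))⁻¹ ≤ 4 ^ n * (volume.real (PsiB Ω y))⁻¹ := by
    rw [← div_eq_mul_inv, le_div_iff₀ pPsi, inv_mul_le_iff₀ pPhi, vPhi, vPsi,
      mul_right_comm, ← mul_pow]
    rw [mul_comm ((dB Ω x' / 6 * 4) ^ n)] 
    rw [mul_comm ((dB Ω y / 2) ^ n)]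
    gcongr
    linarith
  calc _ ≤ (4 ^ n * (volume.real (PsiB Ω y))⁻¹) * ∫ z in PsiB Ω y, |u z - u y| := by
        gcongr
    _ = _ := by ring

lemma local_est {Ω : Set (Euc n)} (hO : IsOpen Ω) (hF : (frontier Ω).Nonempty)
    {s : Euc n → ℝ} {p : ℝ} (hp : 1 ≤ p)
    {u : Euc n → ℝ} (hu : MemN Ω s p u) {x x' : Euc n}
    (hx : x ∈ Ω) (hd : dist x x' ≤ dB Ω x / 20) {D : ℝ} (hD : 0 ≤ D)
    (hDy : ∀ y ∈ PhiB Ω x, dB Ω y ^ (p * s y) ≤ D) {B : Set (Euc n)}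
    (hsubB : PhiB Ω x ⊆ B) :
    |gFun Ω u x - gFun Ω u x'| ^ p ≤
      (4 ^ n) ^ p * (D * ((volume.real (PhiB Ω x))⁻¹ * nuM Ω s p u B)) := by
  have p0 : 0 < p := by linarith
  have dx := dB_pos hO hF hx
  have hsub : PhiB Ω x ⊆ Ω := ball_subO hO hx (by linarith)
  have fPhi : volume (PhiB Ω x) ≠ ⊤ := measure_ball_lt_top.ne
  have iPhi : IntegrableOn u (PhiB Ω x) volume := hu.1.mono_set hsub
  have iNu : IntegrableOn (nuInt Ω s p u) (PhiB Ω x) volume := hu.2.mono_set hsub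
  have mPhi : MeasurableSet (PhiB Ω x) := measurableSet_ball
  have pPhi : 0 < volume.real (PhiB Ω x) := by
    have : volume.real (PhiB Ω x) = _ := volreal_ball x (r := dB Ω x / 6) (by linarith)
    rw [this]
    have v0 := vol_unit_pos (n := n)
    positivity
  set a := gFun Ω u x' with ha
  have iW : IntegrableOn (fun y => |u y - a|) (PhiB Ω x) volume :=
    (iPhi.sub (integrableOn_const fPhi)).abs
  have hW : ∀ y ∈ PhiB Ω x, |u y - a| ^ p ≤ ((4 ^ n) ^ p * D) * nuInt Ω s p u y := by
    intro y hy
    have h1 := local_osc hO hF hu.1 hx hd hy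
    have hG : 0 ≤ ⨍ z in PsiB Ω y, |u z - u y| := by
      rw [setAverage_eq]
      exact smul_nonneg (by positivity) (integral_nonneg fun _ => abs_nonneg _)
    have dy := dB_pos hO hF (hsub hy)
    have h2 : (⨍ z in PsiB Ω y, |u z - u y|) ^ p = nuInt Ω s p u y * dB Ω y ^ (p * s y) := by
      unfold nuInt
      rw [mul_assoc, ← Real.rpow_add dy]; simp
    calc |u y - a| ^ p ≤ (4 ^ n * ⨍ z in PsiB Ω y, |u z - u y|) ^ p :=
          Real.rpow_le_rpow (abs_nonneg _) h1 p0.le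
      _ = (4 ^ n) ^ p * (nuInt Ω s p u y * dB Ω y ^ (p * s y)) := by
          rw [Real.mul_rpow (by positivity) hG, h2]
      _ ≤ (4 ^ n) ^ p * (nuInt Ω s p u y * D) := by
          have := nuInt_nonneg Ω s p u y
          gcongr
          exact hDy y hy
      _ = _ := by ring
  have iWp : IntegrableOn (fun y => |u y - a| ^ p) (PhiB Ω x) volume := by
    refine Integrable.mono' (iNu.const_mul ((4 ^ n) ^ p * D)) ?_ ?_
    · exact (Real.continuous_rpow_const p0.le).comp_aestronglyMeasurable iW.1
    · filter_upwards [ae_restrict_mem mPhi] with y hy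
      rw [Real.norm_of_nonneg (by positivity)]
      exact hW y hy
  have : NeZero (volume.restrict (PhiB Ω x)) := ⟨by
    intro h
    rw [Measure.restrict_eq_zero] at h
    simp [Measure.real, h] at pPhi⟩
  have : IsFiniteMeasure (volume.restrict (PhiB Ω x)) := ⟨by
    rw [Measure.restrict_apply_univ]; exact fPhi.lt_top⟩
  have j1 : |gFun Ω u x - a| ≤ ⨍ y in PhiB Ω x, |u y - a| := by
    have e : gFun Ω u x - a = (volume.real (PhiB Ω x))⁻¹ * ∫ z in PhiB Ω x, (u z - a) := by
      rw [integral_sub iPhi (integrableOn_const fPhi)]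
      unfold gFun
      rw [setAverage_eq, smul_eq_mul]
      simp only [integral_const, smul_eq_mul]
      simp only [measureReal_restrict_apply_univ]
      field_simp
    rw [e, setAverage_eq, smul_eq_mul, abs_mul, abs_of_pos (inv_pos.2 pPhi)]
    gcongr
    exact abs_integral_le_integral_abs
  have j2 : (⨍ y in PhiB Ω x, |u y - a|) ^ p ≤ ⨍ y in PhiB Ω x, |u y - a| ^ p := by
    have := (convexOn_rpow hp).map_average_le (μ := volume.restrict (PhiB Ω x))
      (f := fun y => |u y - a|)
      (Real.continuous_rpow_const p0.le).continuousOn isClosed_Ici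
      (Eventually.of_forall fun y => mem_Ici.2 (abs_nonneg _)) iW iWp
    exact this
  calc |gFun Ω u x - a| ^ p ≤ (⨍ y in PhiB Ω x, |u y - a|) ^ p :=
        Real.rpow_le_rpow (abs_nonneg _) j1 p0.le
    _ ≤ _ := j2
    _ = (volume.real (PhiB Ω x))⁻¹ * ∫ y in PhiB Ω x, |u y - a| ^ p := by
        rw [setAverage_eq, smul_eq_mul]
    _ ≤ (volume.real (PhiB Ω x))⁻¹ * ∫ y in PhiB Ω x, ((4 ^ n) ^ p * D) * nuInt Ω s p u y := by
        exact mul_le_mul_of_nonneg_left (setIntegral_mono_on iWp (iNu.const_mul _) mPhi hW)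
          (inv_nonneg.2 pPhi.le)
    _ = (volume.real (PhiB Ω x))⁻¹ * (((4 ^ n) ^ p * D) * ∫ y in PhiB Ω x, nuInt Ω s p u y) := by
        rw [integral_const_mul]
    _ ≤ (volume.real (PhiB Ω x))⁻¹ * (((4 ^ n) ^ p * D) * nuM Ω s p u B) := by
        gcongr
        unfold nuM
        exact setIntegral_mono_set (hu.2.mono_set inter_subset_left)
          (Eventually.of_forall fun _ => nuInt_nonneg _ _ _ _ _)
          (Eventually.of_forall fun y hy => ⟨hsub hy, hsubB hy⟩)
    _ = _ := by ring

/-- The exponent-dependent factor. -/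
def Hfac (n : ℕ) (p S m R : ℝ) : ℝ :=
  if p * S - n < p then m ^ ((p * S - n) / p - 1) else R ^ ((p * S - n) / p - 1)

/-- The local constant. -/
def cLoc (n : ℕ) (p : ℝ) : ℝ :=
  4 ^ n * ((7 / 6) ^ ((n : ℝ) + p) * 6 ^ n / volume.real (ball (0 : Euc n) 1)) ^ (1 / p)

lemma cLoc_pos (n : ℕ) (p : ℝ) : 0 < cLoc n p := by
  have := vol_unit_pos (n := n)
  unfold cLoc
  positivity

lemma Hfac_nonneg (n : ℕ) (p S : ℝ) {m R : ℝ} (hm : 0 ≤ m) (hR : 0 ≤ R) :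
    0 ≤ Hfac n p S m R := by
  unfold Hfac; split_ifs <;> positivity

lemma nuM_nonneg (Ω : Set (Euc n)) (s : Euc n → ℝ) (p : ℝ) (u : Euc n → ℝ) (B : Set (Euc n)) :
    0 ≤ nuM Ω s p u B := integral_nonneg fun _ => nuInt_nonneg _ _ _ _ _

lemma D_bound {p S m R a b σ : ℝ} (hp : 1 ≤ p) (hS : 0 ≤ S) (hm : 0 < m) (hma : m ≤ a)
    (hb0 : 0 < b) (hbR : b ≤ R) (hR1 : R ≤ 1) (hba : b ≤ 7 / 6 * a) (hσ : S ≤ σ) :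
    b ^ (p * σ) ≤ (7 / 6) ^ ((n : ℝ) + p) * (a ^ n * (a * Hfac n p S m R) ^ p) := by
  have p0 : 0 < p := by linarith
  have a0 : 0 < a := by linarith
  have R0 : 0 < R := by linarith
  have h1 : b ^ (p * σ) ≤ b ^ (p * S) :=
    Real.rpow_le_rpow_of_exponent_ge hb0 (hbR.trans hR1) (by gcongr)
  refine h1.trans ?_
  unfold Hfac
  split_ifs with h
  · have e1 : a * a ^ ((p * S - n) / p - 1) = a ^ ((p * S - n) / p) := by
      nth_rewrite 1 [← Real.rpow_one a]
      rw [← Real.rpow_add a0]; ring_nf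
    have e2 : a ^ n * (a ^ ((p * S - n) / p)) ^ p = a ^ (p * S) := by
      rw [← Real.rpow_mul a0.le, ← Real.rpow_natCast, ← Real.rpow_add a0]
      congr 1; field_simp; ring
    have h2 : a ^ ((p * S - n) / p - 1) ≤ m ^ ((p * S - n) / p - 1) := by
      apply Real.rpow_le_rpow_of_nonpos hm hma
      rw [sub_nonpos, div_le_one p0]; exact h.le
    calc b ^ (p * S) ≤ (7 / 6 * a) ^ (p * S) := by gcongr
      _ = (7 / 6) ^ (p * S) * a ^ (p * S) := Real.mul_rpow (by norm_num) a0.le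
      _ ≤ (7 / 6) ^ ((n : ℝ) + p) * a ^ (p * S) := by
          gcongr
          · norm_num
          · linarith
      _ = (7 / 6) ^ ((n : ℝ) + p) * (a ^ n * (a * a ^ ((p * S - n) / p - 1)) ^ p) := by
          rw [e1, e2]
      _ ≤ _ := by gcongr
  · push Not at h
    have e1 : b ^ (p * S) = b ^ ((n : ℝ) + p) * b ^ (p * S - n - p) := by
      rw [← Real.rpow_add hb0]; ring_nf
    have e2 : (R ^ ((p * S - n) / p - 1)) ^ p = R ^ (p * S - n - p) := by
      rw [← Real.rpow_mul R0.le]; congr 1; field_simp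
    rw [e1, Real.mul_rpow a0.le (by positivity), e2]
    calc b ^ ((n : ℝ) + p) * b ^ (p * S - n - p)
        ≤ (7 / 6 * a) ^ ((n : ℝ) + p) * R ^ (p * S - n - p) := by
          gcongr
      _ = (7 / 6) ^ ((n : ℝ) + p) * (a ^ ((n : ℝ) + p) * R ^ (p * S - n - p)) := by
          rw [Real.mul_rpow (by norm_num) a0.le]; ring
      _ = _ := by
          rw [Real.rpow_add a0, Real.rpow_natCast]; ring

lemma local_est2 {Ω : Set (Euc n)} (hO : IsOpen Ω) (hF : (frontier Ω).Nonempty)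
    {s : Euc n → ℝ} {p : ℝ} (hp : 1 ≤ p)
    {u : Euc n → ℝ} (hu : MemN Ω s p u) {xb x x' : Euc n} (hxb : xb ∈ frontier Ω)
    (hx : x ∈ Ω) (hd : dist x x' ≤ dB Ω x / 20) {S m R : ℝ} (hS : 0 ≤ S)
    (hm : 0 < m) (hmx : m ≤ dB Ω x) (hR1 : R ≤ 1) (hsubB : PhiB Ω x ⊆ ball xb R)
    (hs : ∀ y ∈ Ω ∩ ball xb R, S ≤ s y) :
    |gFun Ω u x - gFun Ω u x'| ≤
      cLoc n p * Hfac n p S m R * nuM Ω s p u (ball xb R) ^ (1 / p) * dB Ω x := by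
  have p0 : 0 < p := by linarith
  have dx := dB_pos hO hF hx
  have hxR : x ∈ ball xb R := hsubB (mem_ball_self (by linarith))
  have R0 : 0 < R := pos_of_mem_ball hxR
  have hH := Hfac_nonneg n p S hm.le R0.le
  have v0 := vol_unit_pos (n := n)
  have hV := nuM_nonneg Ω s p u (ball xb R)
  have h := local_est hO hF hp hu hx hd
    (D := (7 / 6) ^ ((n : ℝ) + p) * (dB Ω x ^ n * (dB Ω x * Hfac n p S m R) ^ p))
    (by positivity) ?_ hsubB
  · have vPhi : volume.real (PhiB Ω x) = (dB Ω x / 6) ^ n * volume.real (ball (0 : Euc n) 1) :=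
      volreal_ball _ (by linarith)
    rw [← Real.rpow_le_rpow_iff (abs_nonneg _) (by have := cLoc_pos n p; positivity) p0]
    refine h.trans_eq ?_
    rw [vPhi]
    unfold cLoc
    have hVp : 0 ≤ nuM Ω s p u (ball xb R) ^ (1 / p) := by positivity
    have hVq : 0 ≤ ((7 / 6) ^ ((n : ℝ) + p) * 6 ^ n / volume.real (ball (0 : Euc n) 1)) ^ (1 / p) :=
      by positivity
    rw [Real.mul_rpow dx.le hH, Real.mul_rpow (by positivity) dx.le,
      Real.mul_rpow (by positivity) hVp,
      Real.mul_rpow (by positivity) hH, Real.mul_rpow (by positivity) hVq,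
      ← Real.rpow_mul (by positivity), ← Real.rpow_mul hV,
      one_div_mul_cancel p0.ne', Real.rpow_one, Real.rpow_one]
    rw [div_pow]
    field_simp
  · intro y hy
    have hyO : y ∈ Ω := ball_subO hO hx (by linarith) hy
    have hyR := hsubB hy
    have h1 := dB_le_dist hxb y
    have h2 : dist y xb < R := hyR
    have h3 := dB_le_add Ω y x
    have h4 : dist y x < dB Ω x / 6 := hy
    exact D_bound hp hS hm hmx (dB_pos hO hF hyO) (by linarith) hR1 (by linarith)
      (hs y ⟨hyO, hyR⟩)

lemma path_est {f dd : Euc n → ℝ} {γ : ℝ → Euc n} (hγ : ContinuousOn γ (Icc 0 1))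
    {K m R L : ℝ} (hK : 0 ≤ K) (hm : 0 < m) (hL : 0 ≤ L)
    (hd : ∀ τ ∈ Icc (0:ℝ) 1, m ≤ dd (γ τ) ∧ dd (γ τ) ≤ R)
    (hf : ∀ τ ∈ Icc (0:ℝ) 1, ∀ x', dist (γ τ) x' ≤ dd (γ τ) / 20 → |f (γ τ) - f x'| ≤ K * dd (γ τ))
    (hv : eVariationOn γ (Icc 0 1) ≤ ENNReal.ofReal L) :
    |f (γ 0) - f (γ 1)| ≤ K * (20 * L + R) := by
  set V : ℝ → ℝ := fun τ => (eVariationOn γ (Icc τ 1)).toReal with hV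
  have fin : ∀ a b : ℝ, 0 ≤ a → b ≤ 1 → eVariationOn γ (Icc a b) ≠ ⊤ := by
    intro a b ha hb
    exact ((eVariationOn.mono γ (Icc_subset_Icc ha hb)).trans_lt
      (hv.trans_lt ENNReal.ofReal_lt_top)).ne
  have hstep : ∀ τ τ' : ℝ, 0 ≤ τ → τ ≤ τ' → τ' ≤ 1 → dist (γ τ) (γ τ') + V τ' ≤ V τ := by
    intro τ τ' h0 h1 h2
    have e := eVariationOn.Icc_add_Icc γ (s := univ) h1 h2 (mem_univ _)
    simp only [univ_inter] at e
    have : edist (γ τ) (γ τ') ≤ eVariationOn γ (Icc τ τ') :=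
      eVariationOn.edist_le _ ⟨le_rfl, h1⟩ ⟨h1, le_rfl⟩
    have h3 : dist (γ τ) (γ τ') ≤ (eVariationOn γ (Icc τ τ')).toReal := by
      rw [dist_edist]
      exact ENNReal.toReal_mono (fin _ _ h0 h2) this
    simp only [hV]
    rw [← e, ENNReal.toReal_add (fin _ _ h0 h2) (fin _ _ (h0.trans h1) le_rfl)]
    linarith
  have hVn : ∀ τ, 0 ≤ V τ := fun τ => ENNReal.toReal_nonneg
  have key : ∀ N : ℕ, ∀ τ ∈ Icc (0:ℝ) 1, V τ ≤ N * (m / 20) →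
      |f (γ τ) - f (γ 1)| ≤ K * (20 * V τ + R) := by
    intro N
    induction N with
    | zero =>
      intro τ hτ hVτ
      have h1 := hstep τ 1 hτ.1 hτ.2 le_rfl
      have h2 := hVn 1
      obtain ⟨d1, d2⟩ := hd τ hτ
      simp only [Nat.cast_zero, zero_mul] at hVτ
      refine (hf τ hτ (γ 1) (by linarith)).trans ?_
      gcongr
      have := hVn τ
      linarith
    | succ N ih =>
      intro τ hτ hVτ
      obtain ⟨d1, d2⟩ := hd τ hτ
      by_cases hc : dist (γ τ) (γ 1) ≤ dd (γ τ) / 20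
      · refine (hf τ hτ (γ 1) hc).trans ?_
        gcongr
        have := hVn τ
        linarith
      · push Not at hc
        have hcont : ContinuousOn (fun τ' => dist (γ τ) (γ τ')) (Icc τ 1) :=
          by
          have := hγ.mono (Icc_subset_Icc hτ.1 (le_refl (1:ℝ)))
          fun_prop
        have := intermediate_value_Icc hτ.2 hcont
        obtain ⟨τ', hτ', e⟩ := this (show dd (γ τ) / 20 ∈ _ from
          ⟨by simp only [dist_self]; linarith, hc.le⟩)
        simp only at e
        have h1 := hstep τ τ' hτ.1 hτ'.1 hτ'.2
        have h2 := ih τ' ⟨hτ.1.trans hτ'.1, hτ'.2⟩ (by push_cast at hVτ; linarith)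
        have h3 := hf τ hτ (γ τ') e.le
        calc |f (γ τ) - f (γ 1)| ≤ |f (γ τ) - f (γ τ')| + |f (γ τ') - f (γ 1)| :=
              abs_sub_le _ _ _
          _ ≤ K * dd (γ τ) + K * (20 * V τ' + R) := add_le_add h3 h2
          _ = K * (dd (γ τ) + 20 * V τ' + R) := by ring
          _ ≤ _ := by gcongr; linarith
  obtain ⟨N, hN⟩ := exists_nat_ge (V 0 / (m / 20))
  have h := key N 0 ⟨le_rfl, zero_le_one⟩ (by rwa [div_le_iff₀ (by positivity)] at hN)
  refine h.trans ?_
  have : V 0 ≤ L := ENNReal.toReal_le_of_le_ofReal hL hv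
  gcongr

lemma alpha_cases {p S θ ω : ℝ} (hθ : 1 ≤ θ) (h : 0 ≤ alphaFun n p S θ + ω) :
    (p * S - n < p → -ω ≤ p + θ * (p * S - n - p)) ∧ (p ≤ p * S - n → -ω ≤ p * S - n) := by
  unfold alphaFun at h
  split_ifs at h with hc
  · exact ⟨fun _ => by nlinarith, fun _ => by linarith⟩
  · push Not at hc
    exact ⟨fun _ => by nlinarith, fun _ => by linarith⟩

lemma Hfac_bound {p S θ ω e ρ C : ℝ} (hp : 1 ≤ p) (hS : 0 ≤ S) (hθ : 1 ≤ θ)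
    (h : 0 ≤ alphaFun n p S θ + ω)
    (he : 0 < e) (he1 : e ≤ 1) (hρ : 0 < ρ) (hC : 1 ≤ C) (hR : 3 * C * ρ ≤ 1) :
    ρ * Hfac n p S (e * ρ ^ θ) (3 * C * ρ) ≤
      (1 + (3 * C) ^ (-ω / p)) * e ^ (-((n : ℝ) + p) / p) * ρ ^ (-ω / p) := by
  have p0 : 0 < p := by linarith
  have hρ1 : ρ ≤ 1 := by nlinarith
  obtain ⟨h1, h2⟩ := alpha_cases hθ h
  have hE : 1 ≤ e ^ (-((n : ℝ) + p) / p) := by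
    apply Real.one_le_rpow_of_pos_of_le_one_of_nonpos he he1
    rw [div_nonpos_iff]; right; constructor
    · have : (0:ℝ) ≤ n := Nat.cast_nonneg n
      linarith
    · exact p0.le
  have hCp : 0 < (3 * C) ^ (-ω / p) := by positivity
  unfold Hfac
  split_ifs with hc
  · have h3 := h1 hc
    rw [Real.mul_rpow he.le (by positivity), ← Real.rpow_mul hρ.le]
    have e1 : ρ * (e ^ ((p * S - n) / p - 1) * ρ ^ (θ * ((p * S - n) / p - 1)))
        = e ^ ((p * S - n) / p - 1) * ρ ^ (1 + θ * ((p * S - n) / p - 1)) := by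
      rw [Real.rpow_add hρ, Real.rpow_one]; ring
    rw [e1]
    have f1 : e ^ ((p * S - n) / p - 1) ≤ e ^ (-((n : ℝ) + p) / p) := by
      apply Real.rpow_le_rpow_of_exponent_ge he he1
      rw [div_sub_one p0.ne']
      gcongr
      nlinarith
    have f2 : ρ ^ (1 + θ * ((p * S - n) / p - 1)) ≤ ρ ^ (-ω / p) := by
      apply Real.rpow_le_rpow_of_exponent_ge hρ hρ1
      rw [div_sub_one p0.ne', div_le_iff₀ p0]
      refine h3.trans_eq ?_
      field_simp
    calc _ ≤ e ^ (-((n : ℝ) + p) / p) * ρ ^ (-ω / p) := by gcongr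
      _ ≤ _ := by
        rw [mul_assoc]
        exact le_mul_of_one_le_left (by positivity) (by linarith)
  · push Not at hc
    have h3 := h2 hc
    have q0 : 0 < 3 * C * ρ := by positivity
    have f1 : ρ * (3 * C * ρ) ^ ((p * S - n) / p - 1) ≤ (3 * C * ρ) ^ (-ω / p) := by
      calc ρ * (3 * C * ρ) ^ ((p * S - n) / p - 1)
          ≤ (3 * C * ρ) * (3 * C * ρ) ^ ((p * S - n) / p - 1) := by
            gcongr; nlinarith
        _ = (3 * C * ρ) ^ ((p * S - n) / p) := by
            nth_rewrite 1 [← Real.rpow_one (3 * C * ρ)]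
            rw [← Real.rpow_add q0]; ring_nf
        _ ≤ _ := by
            apply Real.rpow_le_rpow_of_exponent_ge q0 hR
            gcongr
    refine f1.trans ?_
    rw [Real.mul_rpow (by positivity) hρ.le]
    gcongr
    nlinarith

/-- The constant of the two-point estimate. -/
def cTwo (n : ℕ) (p C ω : ℝ) : ℝ := cLoc n p * (23 * C) * (1 + (3 * C) ^ (-ω / p))

lemma two_pt {Ω : Set (Euc n)} (hO : IsOpen Ω) (hF : (frontier Ω).Nonempty)
    {s : Euc n → ℝ} (hs0 : ∀ x, 0 ≤ s x) {p : ℝ} (hp : 1 ≤ p)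
    {u : Euc n → ℝ} (hu : MemN Ω s p u) {xb : Euc n} (hxb : xb ∈ frontier Ω)
    {C δΓ δ θ ω : ℝ} (hC : 1 ≤ C) (hδ1 : δΓ < 1) (hδ : δ ≤ δΓ) (hθ : 1 ≤ θ)
    {ε : ℝ → ℝ} (hcon : ConnectedTo Ω (Ω ∩ ball xb δΓ) xb C θ (δΓ / (3 * C)) ε)
    (hα : 0 ≤ alphaFun n p (sLow Ω s xb δ) θ + ω)
    {lam ρ : ℝ} (hl0 : 0 < lam) (hl1 : lam < 1) (hρ0 : 0 < ρ) (hρ : ρ ≤ δ / (3 * C))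
    {x x' : Euc n} (hx : x ∈ Ω) (hxρ : x ∈ ball xb ρ) (hx' : x' ∈ Ω) (hxρ' : x' ∈ ball xb ρ)
    (hdx : (lam * ρ) ^ θ ≤ dB Ω x) (hdx' : (lam * ρ) ^ θ ≤ dB Ω x') :
    |gFun Ω u x - gFun Ω u x'| ≤ cTwo n p C ω * ε lam ^ (-((n : ℝ) + p) / p) *
      ρ ^ (-ω / p) * nuM Ω s p u (ball xb (3 * C * ρ)) ^ (1 / p) := by
  have p0 : 0 < p := by linarith
  obtain ⟨he0, hel, hpath⟩ := hcon lam hl0 hl1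
  have hRδ : 3 * C * ρ ≤ δ := by
    rw [le_div_iff₀ (by positivity)] at hρ; linarith
  have hρδ : ρ ≤ δΓ := by nlinarith
  have hbs : ball xb ρ ⊆ ball xb δΓ := ball_subset_ball hρδ
  obtain ⟨γ, γc, γ0, γ1, hγ, hvar⟩ := hpath ρ hρ0 (hρ.trans (by gcongr)) x ⟨⟨hx, hbs hxρ⟩, hxρ⟩
    x' ⟨⟨hx', hbs hxρ'⟩, hxρ'⟩ hdx hdx'
  have hSlow : ∀ y ∈ Ω ∩ ball xb δ, sLow Ω s xb δ ≤ s y := by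
    intro y hy
    exact csInf_le ⟨0, by rintro _ ⟨z, _, rfl⟩; exact hs0 z⟩ ⟨y, hy, rfl⟩
  have hS : 0 ≤ sLow Ω s xb δ := Real.sInf_nonneg (by rintro _ ⟨z, _, rfl⟩; exact hs0 z)
  set S := sLow Ω s xb δ with hSdef
  set m := ε lam * ρ ^ θ with hm
  have m0 : 0 < m := by positivity
  set R := 3 * C * ρ with hR
  have R0 : 0 < R := by positivity
  have hH := Hfac_nonneg n p S m0.le R0.le
  have hV := nuM_nonneg Ω s p u (ball xb R)
  have hdist : ∀ τ ∈ Icc (0:ℝ) 1, dist (γ τ) xb ≤ 2 * C * ρ := by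
    intro τ hτ
    have h1 : edist (γ τ) (γ 0) ≤ ENNReal.ofReal (C * ρ) :=
      (eVariationOn.edist_le _ hτ ⟨le_rfl, zero_le_one⟩).trans hvar
    rw [γ0, edist_dist] at h1
    have h2 : dist (γ τ) x ≤ C * ρ := by
      rwa [ENNReal.ofReal_le_ofReal_iff (by positivity)] at h1
    have h3 := dist_triangle (γ τ) x xb
    have h4 : dist x xb < ρ := hxρ
    nlinarith
  have key := path_est (f := gFun Ω u) (dd := dB Ω) γc
    (K := cLoc n p * Hfac n p S m R * nuM Ω s p u (ball xb R) ^ (1 / p)) (m := m) (R := R)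
    (L := C * ρ) (by have := cLoc_pos n p; positivity) m0 (by positivity)
    (fun τ hτ => ⟨(hγ τ hτ).2, by
      have := dB_le_dist hxb (γ τ)
      have := hdist τ hτ
      rw [hR]; nlinarith⟩) ?_ hvar
  · rw [γ0, γ1] at key
    refine key.trans ?_
    have hb := Hfac_bound (n := n) hp hS hθ hα he0 (hel.trans hl1.le) hρ0 hC (hRδ.trans (by linarith))
    have hc := cLoc_pos n p
    calc cLoc n p * Hfac n p S m R * nuM Ω s p u (ball xb R) ^ (1 / p) * (20 * (C * ρ) + R)
        = cLoc n p * (23 * C) * nuM Ω s p u (ball xb R) ^ (1 / p) * (ρ * Hfac n p S m R) := by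
          rw [hR]; ring
      _ ≤ cLoc n p * (23 * C) * nuM Ω s p u (ball xb R) ^ (1 / p) *
          ((1 + (3 * C) ^ (-ω / p)) * ε lam ^ (-((n : ℝ) + p) / p) * ρ ^ (-ω / p)) := by
          gcongr
      _ = _ := by unfold cTwo; ring
  · intro τ hτ x'' hx''
    refine local_est2 hO hF hp hu hxb (hγ τ hτ).1.1 hx'' hS m0 (hγ τ hτ).2 (hRδ.trans (by linarith))
      ?_ ?_
    · apply ball_subset_ball'
      have := dB_le_dist hxb (γ τ)
      have := hdist τ hτ
      rw [hR]; nlinarith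
    · intro y hy
      exact hSlow y ⟨hy.1, ball_subset_ball hRδ hy.2⟩

lemma mink {α : Type*} [MeasurableSpace α] {μ : Measure α} {f : ℕ → α → ℝ≥0∞}
    (hf : ∀ j, Measurable (f j)) {p : ℝ} (hp : 1 ≤ p) :
    (∫⁻ x, (∑' j, f j x) ^ p ∂μ) ^ (1 / p) ≤ ∑' j, (∫⁻ x, f j x ^ p ∂μ) ^ (1 / p) := by
  have p0 : 0 < p := by linarith
  have fin : ∀ N : ℕ, (∫⁻ x, (∑ j ∈ Finset.range N, f j x) ^ p ∂μ) ^ (1 / p) ≤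
      ∑ j ∈ Finset.range N, (∫⁻ x, f j x ^ p ∂μ) ^ (1 / p) := by
    intro N
    induction N with
    | zero => simp [p0]
    | succ N ih =>
      rw [Finset.sum_range_succ]
      have h := ENNReal.lintegral_Lp_add_le (μ := μ) (f := fun x => ∑ j ∈ Finset.range N, f j x)
        (g := f N) (Finset.measurable_fun_sum _ fun j _ => hf j).aemeasurable
        (hf N).aemeasurable hp
      simp only [Pi.add_apply] at h
      simp only [Finset.sum_range_succ]
      exact h.trans (by gcongr)
  have lim : Tendsto (fun N : ℕ => ∫⁻ x, (∑ j ∈ Finset.range N, f j x) ^ p ∂μ) atTop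
      (𝓝 (∫⁻ x, (∑' j, f j x) ^ p ∂μ)) := by
    apply lintegral_tendsto_of_tendsto_of_monotone
    · intro N
      exact ((Finset.measurable_fun_sum _ fun j _ => hf j).pow_const p).aemeasurable
    · refine Eventually.of_forall fun x N M hNM => ?_
      apply ENNReal.rpow_le_rpow _ p0.le
      exact Finset.sum_le_sum_of_subset (Finset.range_mono hNM)
    · refine Eventually.of_forall fun x => ?_
      exact ((ENNReal.continuous_rpow_const (y := p)).tendsto _).comp
        (ENNReal.tendsto_nat_tsum fun j => f j x)
  have lim2 := ((ENNReal.continuous_rpow_const (y := 1 / p)).tendsto _).comp lim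
  refine le_of_tendsto' lim2 fun N => ?_
  exact (fin N).trans (ENNReal.sum_le_tsum _)

lemma sigma_fin {Γ G : Set (Euc n)} {t A : ℝ} (hG : G ⊆ Γ)
    (hA : ∀ xb ∈ Γ, ∀ ρ : ℝ, 0 < ρ → μH[t] (Γ ∩ ball xb ρ) ≤ ENNReal.ofReal (A * ρ ^ t)) :
    SigmaFinite ((μH[t] : Measure (Euc n)).restrict G) := by
  rcases G.eq_empty_or_nonempty with rfl | ⟨x, hx⟩
  · rw [Measure.restrict_empty]; infer_instance
  · refine ⟨⟨⟨fun N : ℕ => ball x (N + 1), fun _ => trivial, fun N => ?_, ?_⟩⟩⟩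
    · rw [Measure.restrict_apply measurableSet_ball]
      refine lt_of_le_of_lt (measure_mono ?_) ((hA x (hG hx) (N + 1) (by positivity)).trans_lt
        ENNReal.ofReal_lt_top)
      exact fun y hy => ⟨hG hy.2, hy.1⟩
    · rw [iUnion_eq_univ_iff]
      intro y
      obtain ⟨N, hN⟩ := exists_nat_gt (dist y x)
      exact ⟨N, by rw [mem_ball]; linarith⟩

lemma tonelli {Γ G : Set (Euc n)} {t A : ℝ} (hG : G ⊆ Γ)
    (hA : ∀ xb ∈ Γ, ∀ ρ : ℝ, 0 < ρ → μH[t] (Γ ∩ ball xb ρ) ≤ ENNReal.ofReal (A * ρ ^ t))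
    (μ : Measure (Euc n)) [IsFiniteMeasure μ] {r : ℝ} (hr : 0 < r) :
    ∫⁻ x in G, μ (ball x r) ∂μH[t] ≤ ENNReal.ofReal (A * (2 * r) ^ t) * μ (thickening r G) := by
  have := sigma_fin hG hA
  have hS : MeasurableSet {q : Euc n × Euc n | dist q.2 q.1 < r} :=
    (isOpen_lt (by fun_prop) (by fun_prop)).measurableSet
  have e1 := Measure.prod_apply (μ := (μH[t] : Measure (Euc n)).restrict G) (ν := μ) hS
  have e2 := Measure.prod_apply_symm (μ := (μH[t] : Measure (Euc n)).restrict G) (ν := μ) hS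
  have e3 : ∀ x : Euc n, Prod.mk x ⁻¹' {q : Euc n × Euc n | dist q.2 q.1 < r} = ball x r := by
    intro x; ext y; simp
  have e4 : ∀ y : Euc n, (fun x => (x, y)) ⁻¹' {q : Euc n × Euc n | dist q.2 q.1 < r} = ball y r := by
    intro x; ext y; simp [dist_comm]
  simp only [e3] at e1
  simp only [e4] at e2
  rw [← e1, e2]
  calc ∫⁻ y, (μH[t]).restrict G (ball y r) ∂μ
      ≤ ∫⁻ y, (thickening r G).indicator (fun _ => ENNReal.ofReal (A * (2 * r) ^ t)) y ∂μ := by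
        apply lintegral_mono
        intro y
        simp only
        rw [Measure.restrict_apply measurableSet_ball]
        by_cases hy : y ∈ thickening r G
        · rw [indicator_of_mem hy]
          obtain ⟨z, hz, hyz⟩ := mem_thickening_iff.1 hy
          refine (measure_mono ?_).trans (hA z (hG hz) (2 * r) (by linarith))
          rintro w ⟨hw, hwG⟩
          refine ⟨hG hwG, ?_⟩
          rw [mem_ball] at *
          have := dist_triangle w y z
          linarith
        · have : ball y r ∩ G = ∅ := by
            rw [eq_empty_iff_forall_notMem]
            rintro w ⟨hw, hwG⟩
            exact hy (mem_thickening_iff.2 ⟨w, hwG, by rwa [mem_ball, dist_comm] at hw⟩)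
          rw [this]; simp
    _ = _ := by
        rw [lintegral_indicator isOpen_thickening.measurableSet, lintegral_const,
          Measure.restrict_apply_univ]

/-- The measure `ν(·;u)`. -/
def nuMeas (Ω : Set (Euc n)) (s : Euc n → ℝ) (p : ℝ) (u : Euc n → ℝ) : Measure (Euc n) :=
  (volume.restrict Ω).withDensity (fun x => ENNReal.ofReal (nuInt Ω s p u x))

lemma nuMeas_apply {Ω : Set (Euc n)} {s : Euc n → ℝ} {p : ℝ} {u : Euc n → ℝ}
    (hu : MemN Ω s p u) {E : Set (Euc n)} (hE : MeasurableSet E) :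
    nuMeas Ω s p u E = ENNReal.ofReal (nuM Ω s p u E) := by
  unfold nuMeas nuM
  rw [withDensity_apply _ hE, Measure.restrict_restrict hE, inter_comm E Ω,
    ofReal_integral_eq_lintegral_ofReal (hu.2.mono_set inter_subset_left)
      (Eventually.of_forall fun _ => nuInt_nonneg _ _ _ _ _)]

lemma nuMeas_fin {Ω : Set (Euc n)} {s : Euc n → ℝ} {p : ℝ} {u : Euc n → ℝ}
    (hu : MemN Ω s p u) : IsFiniteMeasure (nuMeas Ω s p u) :=
  isFiniteMeasure_withDensity_ofReal hu.2.2

lemma pointwise {Ω : Set (Euc n)} (hO : IsOpen Ω) (hF : (frontier Ω).Nonempty)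
    {s : Euc n → ℝ} (hs0 : ∀ x, 0 ≤ s x) {p : ℝ} (hp : 1 ≤ p)
    {u : Euc n → ℝ} (hu : MemN Ω s p u) {xb : Euc n} (hxb : xb ∈ frontier Ω)
    {C δΓ δ θ ω : ℝ} (hC : 1 ≤ C) (hδ1 : δΓ < 1) (hδ : δ ≤ δΓ) (hθ : 1 ≤ θ)
    {ε : ℝ → ℝ} (hcon : ConnectedTo Ω (Ω ∩ ball xb δΓ) xb C θ (δΓ / (3 * C)) ε)
    (hα : 0 ≤ alphaFun n p (sLow Ω s xb δ) θ + ω)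
    {lam lam₀ η₀ η ρ : ℝ} (hl0 : 0 < lam) (hl : lam ≤ lam₀) (hl1 : lam₀ < 1)
    (hη0 : 0 < η) (hηh : η ≤ 1 / 2) (hηη : η ≤ η₀)
    (hcork : IsCorkscrew Ω (Qreg Ω lam₀ θ xb) xb η₀ θ δΓ)
    {T : ℝ} (hT : Tendsto (gFun Ω u) (𝓝[Qreg Ω lam₀ θ xb] xb) (𝓝 T))
    (hρ0 : 0 < ρ) (hρ : ρ ≤ δ / (3 * C)) :
    ENNReal.ofReal |T - ⨍ x in (Qreg Ω lam θ xb ∩ ball xb ρ) \ ball xb (η * ρ), gFun Ω u x| ≤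
      ∑' j : ℕ, 2 * ENNReal.ofReal (cTwo n p C ω * ε (η ^ 2 * lam) ^ (-((n : ℝ) + p) / p) *
        (η ^ j * ρ) ^ (-ω / p) * nuM Ω s p u (ball xb (3 * C * (η ^ j * ρ))) ^ (1 / p)) := by
  have p0 : 0 < p := by linarith
  have θ0 : 0 < θ := by linarith
  have hρδ : ρ ≤ δΓ := by
    rw [le_div_iff₀ (by positivity)] at hρ; nlinarith
  set a : ℕ → ℝ := fun j => cTwo n p C ω * ε (η ^ 2 * lam) ^ (-((n : ℝ) + p) / p) *
        (η ^ j * ρ) ^ (-ω / p) * nuM Ω s p u (ball xb (3 * C * (η ^ j * ρ))) ^ (1 / p) with ha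
  have hj0 : ∀ j : ℕ, 0 < η ^ j * ρ := fun j => by positivity
  have hj1 : ∀ j : ℕ, η ^ j * ρ ≤ ρ := fun j =>
    mul_le_of_le_one_left hρ0.le (pow_le_one₀ hη0.le (by linarith))
  have hl'0 : 0 < η ^ 2 * lam := by positivity
  have hl'1 : η ^ 2 * lam < 1 := by nlinarith
  choose x hxQ hx1 hx2 hx3 using fun j : ℕ => hcork (η ^ j * ρ) (hj0 j) ((hj1 j).trans hρδ)
  -- the two point bound at scale `j`
  have tp : ∀ j : ℕ, ∀ y y' : Euc n, y ∈ Qreg Ω lam θ xb → y' ∈ Qreg Ω lam θ xb →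
      dist xb y < η ^ j * ρ → dist xb y' < η ^ j * ρ → η ^ 2 * (η ^ j * ρ) ≤ dist xb y →
      η ^ 2 * (η ^ j * ρ) ≤ dist xb y' → |gFun Ω u y - gFun Ω u y'| ≤ a j := by
    intro j y y' hy hy' h1 h1' h2 h2'
    have aux : ∀ z : Euc n, z ∈ Qreg Ω lam θ xb → η ^ 2 * (η ^ j * ρ) ≤ dist xb z →
        (η ^ 2 * lam * (η ^ j * ρ)) ^ θ ≤ dB Ω z := by
      intro z hz hz2
      refine le_trans ?_ hz.2.le
      apply Real.rpow_le_rpow (by have := hj0 j; positivity) _ θ0.le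
      nlinarith
    exact two_pt hO hF hs0 hp hu hxb hC hδ1 hδ hθ hcon hα hl'0 hl'1 (hj0 j) ((hj1 j).trans hρ)
      hy.1 (by rwa [mem_ball, dist_comm]) hy'.1 (by rwa [mem_ball, dist_comm])
      (aux y hy h2) (aux y' hy' h2')
  have hQQ : Qreg Ω lam₀ θ xb ⊆ Qreg Ω lam θ xb := by
    intro z hz
    refine ⟨hz.1, lt_of_le_of_lt ?_ hz.2⟩
    apply Real.rpow_le_rpow (by positivity) _ θ0.le
    gcongr
  have hx1' : ∀ j : ℕ, η * (η ^ j * ρ) < dist xb (x j) := fun j =>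
    lt_of_le_of_lt (mul_le_mul_of_nonneg_right hηη (hj0 j).le) (hx1 j)
  have hsq : ∀ r : ℝ, 0 < r → η ^ 2 * r ≤ η * r := by
    intro r hr
    have : η ^ 2 ≤ η := by nlinarith
    gcongr
  have step : ∀ j : ℕ, edist (gFun Ω u (x j)) (gFun Ω u (x j.succ)) ≤ ENNReal.ofReal (a j) := by
    intro j
    rw [edist_dist, Real.dist_eq]
    apply ENNReal.ofReal_le_ofReal
    have hsc : η ^ (j + 1) * ρ = η * (η ^ j * ρ) := by ring
    have h1 := hx1' (j + 1)
    have h2 := hx2 (j + 1)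
    rw [hsc] at h1 h2
    refine tp j _ _ (hQQ (hxQ _)) (hQQ (hxQ _)) (hx2 j) ?_ ((hsq _ (hj0 j)).trans (hx1' j).le) ?_
    · refine h2.trans_le ?_
      have := hj0 j
      nlinarith
    · refine le_trans (le_of_eq ?_) h1.le
      ring
  have hlim : Tendsto (fun j => gFun Ω u (x j)) atTop (𝓝 T) := by
    refine hT.comp ?_
    refine tendsto_nhdsWithin_iff.2 ⟨?_, Eventually.of_forall hxQ⟩
    rw [tendsto_iff_dist_tendsto_zero]
    refine squeeze_zero (fun _ => dist_nonneg) (fun j => ?_)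
      (g := fun j : ℕ => η ^ j * ρ) ?_
    · rw [dist_comm]; exact (hx2 j).le
    · have := (tendsto_pow_atTop_nhds_zero_of_lt_one hη0.le (by linarith : η < 1)).mul_const ρ
      simpa using this
  have hsum := edist_le_tsum_of_edist_le_of_tendsto₀ _ step hlim
  -- the average
  set A := (Qreg Ω lam θ xb ∩ ball xb ρ) \ ball xb (η * ρ) with hA
  have hQopen : IsOpen (Qreg Ω lam θ xb) := by
    have : Qreg Ω lam θ xb = Ω ∩ {x | (lam * dist xb x) ^ θ < dB Ω x} := rfl
    rw [this]
    refine hO.inter (isOpen_lt ?_ (dB_cont Ω))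
    exact (Real.continuous_rpow_const θ0.le).comp (by fun_prop)
  have hAm : MeasurableSet A := (hQopen.measurableSet.inter measurableSet_ball).diff measurableSet_ball
  have hAfin : volume A ≠ ⊤ :=
    (lt_of_le_of_lt (measure_mono (sdiff_subset.trans inter_subset_right)) measure_ball_lt_top).ne
  have hx0 := hx1' 0
  have hx0' := hx2 0
  rw [pow_zero, one_mul] at hx0 hx0'
  have hA0 : 0 < volume A := by
    have hU : IsOpen ((Qreg Ω lam θ xb ∩ ball xb ρ) ∩ {z | η * ρ < dist xb z}) :=
      (hQopen.inter isOpen_ball).inter (isOpen_lt (by fun_prop) (by fun_prop))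
    refine lt_of_lt_of_le (hU.measure_pos volume ⟨x 0, ⟨hQQ (hxQ 0), ?_⟩, hx0⟩) (measure_mono ?_)
    · rwa [mem_ball, dist_comm]
    · rintro z ⟨h1, h2⟩
      refine ⟨h1, ?_⟩
      rw [mem_ball, dist_comm, not_lt]
      exact (show η * ρ < dist xb z from h2).le
  have hbd : ∀ z ∈ A, |gFun Ω u (x 0) - gFun Ω u z| ≤ a 0 := by
    rintro z ⟨⟨hz1, hz2⟩, hz3⟩
    rw [mem_ball, dist_comm] at hz2
    rw [mem_ball, dist_comm, not_lt] at hz3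
    refine tp 0 _ _ (hQQ (hxQ 0)) hz1 ?_ ?_ ?_ ?_ <;> rw [pow_zero, one_mul]
    · exact hx0'
    · exact hz2
    · exact (hsq _ hρ0).trans hx0.le
    · exact (hsq _ hρ0).trans hz3
  have hAO : A ⊆ Ω := fun z hz => hz.1.1.1
  have hgm : AEStronglyMeasurable (gFun Ω u) (volume.restrict A) :=
    (gFun_meas hO hu.1).mono_measure (Measure.restrict_mono hAO le_rfl)
  have hgi : IntegrableOn (gFun Ω u) A volume := by
    refine Integrable.mono' (g := fun _ => |gFun Ω u (x 0)| + a 0)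
      (integrableOn_const hAfin) hgm ?_
    filter_upwards [ae_restrict_mem hAm] with z hz
    have h1 := hbd z hz
    rw [Real.norm_eq_abs]
    have h2 := abs_sub_abs_le_abs_sub (gFun Ω u z) (gFun Ω u (x 0))
    rw [abs_sub_comm] at h2
    linarith
  have hav : |gFun Ω u (x 0) - ⨍ z in A, gFun Ω u z| ≤ a 0 := by
    have hcm : ⨍ z in A, gFun Ω u z ∈ closedBall (gFun Ω u (x 0)) (a 0) := by
      refine (convex_closedBall _ _).set_average_mem isClosed_closedBall hA0.ne' hAfin ?_ hgi
      filter_upwards [ae_restrict_mem hAm] with z hz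
      rw [mem_closedBall, dist_comm, Real.dist_eq]
      exact hbd z hz
    rwa [mem_closedBall, dist_comm, Real.dist_eq] at hcm
  have hfin : ENNReal.ofReal |T - ⨍ z in A, gFun Ω u z| ≤
      edist (gFun Ω u (x 0)) T + ENNReal.ofReal (a 0) := by
    rw [← Real.dist_eq, ← edist_dist]
    refine (edist_triangle_left _ _ (gFun Ω u (x 0))).trans (add_le_add le_rfl ?_)
    rw [edist_dist, Real.dist_eq]
    exact ENNReal.ofReal_le_ofReal hav
  rw [ENNReal.tsum_mul_left, two_mul]
  exact hfin.trans (add_le_add hsum (ENNReal.le_tsum 0))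

/-- `Lᵖ` bound for `Tu − g_ρ`. Under (H1), (H2) and (H4′), for
`Γ″ ⊆ A_{ω,δ} ∩ Γ_t` (`ω < t`) and `g_ρ(xb) := ⨍_{Q_{λ,ρ}(xb)∖B(xb,η₁ρ)} g(x;u) dx`, one has
`‖Tu − g_ρ‖_{Lᵖ(Γ″)} ≤ C₁ η₁^{k(t−ω)/p} ν(B_{2η₁^kδ_Γ}(Γ″);u)^{1/p}`, where
`C₁ = c ε_{λ′}^{-(n+p)/p}(1−η₁^{(t−ω)/p})⁻¹`, `λ′ = η₁²λ`. -/
theorem statement14 (n : ℕ) (hn : 1 ≤ n) (p t AΓ CΓ δΓ ω : ℝ)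
    (hp : 1 ≤ p) (ht : 0 ≤ t) (htn : t < n) (hAΓ : 1 ≤ AΓ) (hCΓ : 1 ≤ CΓ)
    (hδΓ0 : 0 < δΓ) (hδΓ1 : δΓ < 1) (hω : ω < t) :
    ∃ c : ℝ, 0 < c ∧
      ∀ (Ω : Set (Euc n)), IsOpen Ω → Ω.Nonempty → (frontier Ω).Nonempty →
      ∀ (Γ : Set (Euc n)), Γ ⊆ frontier Ω →
      ∀ (θΓ : Euc n → ℝ), (∀ xb, 1 ≤ θΓ xb) → (∃ b : ℝ, ∀ xb, θΓ xb ≤ b) →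
      ∀ (s : Euc n → ℝ), Measurable s → (∀ x, 0 ≤ s x) → (∃ b : ℝ, ∀ x, s x ≤ b) →
      ∀ (lam₀ η₀ : ℝ), 0 < lam₀ → lam₀ < 1 → 0 < η₀ → η₀ < 1 →
      (∀ xb ∈ Γ, IsCorkscrew Ω (Qreg Ω lam₀ (θΓ xb) xb) xb η₀ (θΓ xb) δΓ) →
      ∀ (ε : ℝ → ℝ), (∀ a b : ℝ, 0 < a → a ≤ b → b < 1 → ε a ≤ ε b) →
      (∀ xb ∈ Γ, ConnectedTo Ω (Ω ∩ ball xb δΓ) xb CΓ (θΓ xb) (δΓ / (3 * CΓ)) ε) →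
      (∀ xb ∈ Γ, ∀ ρ : ℝ, 0 < ρ → μH[t] (Γ ∩ ball xb ρ) ≤ ENNReal.ofReal (AΓ * ρ ^ t)) →
      ∀ (u : Euc n → ℝ), MemN Ω s p u →
      ∀ (lam : ℝ), 0 < lam → lam ≤ lam₀ →
      ∀ (k : ℕ) (δ : ℝ), 0 < δ → δ ≤ min (1/2) η₀ ^ k * δΓ →
      ∀ (Γ'' : Set (Euc n)), MeasurableSet Γ'' →
        Γ'' ⊆ {xb ∈ Γ | 0 ≤ alphaLow Ω s p θΓ xb δ + ω} ∩ GammaTau Ω s p u Γ t →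
      ∀ (Tu : Euc n → ℝ), AEMeasurable Tu (μH[t].restrict Γ'') →
        (∀ xb ∈ Γ'', Tendsto (gFun Ω u) (𝓝[Qreg Ω lam₀ (θΓ xb) xb] xb) (𝓝 (Tu xb))) →
      ∀ (ρ : ℝ), 0 < ρ → ρ ≤ δ / (3 * CΓ) →
        (∫⁻ xb in Γ'',
            ENNReal.ofReal
              (|Tu xb - ⨍ x in (Qreg Ω lam (θΓ xb) xb ∩ ball xb ρ) \
                  ball xb (min (1/2) η₀ * ρ), gFun Ω u x| ^ p) ∂μH[t]) ^ (1 / p : ℝ) ≤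
          ENNReal.ofReal
            ((c * ε (min (1/2) η₀ ^ 2 * lam) ^ (-((n : ℝ) + p) / p) *
                (1 - min (1/2) η₀ ^ ((t - ω) / p))⁻¹) *
              min (1/2) η₀ ^ ((k : ℝ) * (t - ω) / p) *
              nuM Ω s p u (thickening (2 * min (1/2) η₀ ^ k * δΓ) Γ'') ^ (1 / p)) := by
  have p0 : 0 < p := by linarith
  have hcT : 0 < cTwo n p CΓ ω := by
    have := cLoc_pos n p
    unfold cTwo; positivity
  refine ⟨2 * cTwo n p CΓ ω * AΓ ^ (1 / p) * (6 * CΓ) ^ (t / p), by positivity, ?_⟩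
  intro Ω hO _ hF Γ hΓ θΓ hθ _ s hsm hs0 _ lam₀ η₀ hl0 hl1 hη0 hη1 hcork ε hε hcon hA u hu lam
    hlam hlam0 k δ hδ0 hδ G hGm hG Tu hTm hT ρ hρ0 hρ
  set η := min (1 / 2) η₀ with hη
  have ηpos : 0 < η := lt_min (by norm_num) hη0
  have ηh : η ≤ 1 / 2 := min_le_left _ _
  have ηle : η ≤ η₀ := min_le_right _ _
  have hGΓ : G ⊆ Γ := fun x hx => (hG hx).1.1
  set κ := (t - ω) / p with hκ
  have κ0 : 0 < κ := div_pos (by linarith) p0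
  have hηk : η ^ k ≤ 1 := pow_le_one₀ ηpos.le (by linarith)
  have hδΓ' : δ ≤ δΓ := hδ.trans (mul_le_of_le_one_left hδΓ0.le hηk)
  rcases G.eq_empty_or_nonempty with rfl | ⟨x₀, hx₀⟩
  · simp [p0]
  have hl'0 : 0 < η ^ 2 * lam := by positivity
  have hl'1 : η ^ 2 * lam < 1 := by nlinarith
  have he0 : 0 < ε (η ^ 2 * lam) := (hcon x₀ (hGΓ hx₀) _ hl'0 hl'1).1
  set E := ε (η ^ 2 * lam) ^ (-((n : ℝ) + p) / p) with hE
  have E0 : 0 < E := by positivity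
  set V := nuM Ω s p u (thickening (2 * η ^ k * δΓ) G) with hV
  have V0 : 0 ≤ V := nuM_nonneg _ _ _ _ _
  have hfin := nuMeas_fin hu
  set ν := nuMeas Ω s p u with hν
  -- radii
  have hr0 : ∀ j : ℕ, 0 < η ^ j * ρ := fun j => by positivity
  have hj1 : ∀ j : ℕ, η ^ j * ρ ≤ ρ := fun j =>
    mul_le_of_le_one_left hρ0.le (pow_le_one₀ ηpos.le (by linarith))
  have hρδ : 3 * CΓ * ρ ≤ δ := by
    rw [le_div_iff₀ (by positivity)] at hρ; linarith
  set f : ℕ → Euc n → ℝ≥0∞ := fun j xb => 2 * (ENNReal.ofReal (cTwo n p CΓ ω * E *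
    (η ^ j * ρ) ^ (-ω / p)) * ν (ball xb (3 * CΓ * (η ^ j * ρ))) ^ (1 / p)) with hf
  have hball : ∀ r : ℝ, Measurable fun xb : Euc n => ν (ball xb r) := by
    intro r
    have hS : MeasurableSet {q : Euc n × Euc n | dist q.2 q.1 < r} :=
      (isOpen_lt (by fun_prop) (by fun_prop)).measurableSet
    have := measurable_measure_prodMk_left (ν := ν) hS
    have e3 : ∀ x : Euc n, Prod.mk x ⁻¹' {q : Euc n × Euc n | dist q.2 q.1 < r} = ball x r := by
      intro x; ext y; simp
    simpa only [e3] using this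
  have hfm : ∀ j, Measurable (f j) := fun j =>
    (((hball _).pow_const _).const_mul _).const_mul _
  have hpt : ∀ xb ∈ G, ENNReal.ofReal (|Tu xb - ⨍ x in (Qreg Ω lam (θΓ xb) xb ∩ ball xb ρ) \
                  ball xb (η * ρ), gFun Ω u x| ^ p) ≤ (∑' j, f j xb) ^ p := by
    intro xb hxb
    rw [← ENNReal.ofReal_rpow_of_nonneg (abs_nonneg _) p0.le]
    apply ENNReal.rpow_le_rpow _ p0.le
    refine (pointwise hO hF hs0 hp hu (hΓ (hGΓ hxb)) hCΓ hδΓ1 hδΓ' (hθ xb) (hcon xb (hGΓ hxb))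
      (hG hxb).1.2 hlam hlam0 hl1 ηpos ηh ηle (hcork xb (hGΓ hxb)) (hT xb hxb) hρ0 hρ).trans ?_
    refine ENNReal.tsum_le_tsum fun j => ?_
    simp only [hf]
    have := hr0 j
    rw [nuMeas_apply hu measurableSet_ball, ENNReal.ofReal_rpow_of_nonneg (nuM_nonneg _ _ _ _ _)
      (by positivity), ← ENNReal.ofReal_mul (by positivity)]
  have hterm : ∀ j : ℕ, (∫⁻ xb in G, f j xb ^ p ∂μH[t]) ^ (1 / p) ≤
      ENNReal.ofReal ((2 * cTwo n p CΓ ω * AΓ ^ (1 / p) * (6 * CΓ) ^ (t / p)) * E * ρ ^ κ *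
        V ^ (1 / p) * (η ^ κ) ^ j) := by
    intro j
    have hrj := hr0 j
    set r := η ^ j * ρ with hr
    have hR0 : 0 < 3 * CΓ * r := by positivity
    set a := cTwo n p CΓ ω * E * r ^ (-ω / p) with ha
    have ha0 : 0 ≤ a := by positivity
    have e1 : ∀ xb, f j xb ^ p = ENNReal.ofReal ((2 * a) ^ p) * ν (ball xb (3 * CΓ * r)) := by
      intro xb
      have h2a : ENNReal.ofReal (2 * a) = 2 * ENNReal.ofReal a := by
        rw [ENNReal.ofReal_mul (by norm_num)]; simp
      show (2 * (ENNReal.ofReal a * ν (ball xb (3 * CΓ * r)) ^ (1 / p))) ^ p = _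
      rw [← ENNReal.ofReal_rpow_of_nonneg (by positivity) p0.le, h2a, ← mul_assoc,
        ENNReal.mul_rpow_of_nonneg _ _ p0.le, ← ENNReal.rpow_mul, one_div_mul_cancel p0.ne',
        ENNReal.rpow_one]
    simp only [e1]
    rw [lintegral_const_mul _ (hball _)]
    have hν1 : ν (thickening (3 * CΓ * r) G) ≤ ENNReal.ofReal V := by
      rw [hV, ← nuMeas_apply hu isOpen_thickening.measurableSet]
      apply measure_mono
      apply thickening_mono
      have : 3 * CΓ * r ≤ 3 * CΓ * ρ := by
        have := hj1 j
        gcongr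
      have h3 : 0 < η ^ k * δΓ := by positivity
      linarith
    calc (ENNReal.ofReal ((2 * a) ^ p) * ∫⁻ xb in G, ν (ball xb (3 * CΓ * r)) ∂μH[t]) ^ (1 / p)
        ≤ (ENNReal.ofReal ((2 * a) ^ p) * (ENNReal.ofReal (AΓ * (2 * (3 * CΓ * r)) ^ t) *
            ENNReal.ofReal V)) ^ (1 / p) := by
          gcongr
          exact (tonelli hGΓ hA ν hR0).trans (by gcongr)
      _ = ENNReal.ofReal (((2 * a) ^ p * (AΓ * (2 * (3 * CΓ * r)) ^ t * V)) ^ (1 / p)) := by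
          rw [← ENNReal.ofReal_mul (by positivity), ← ENNReal.ofReal_mul (by positivity),
            ENNReal.ofReal_rpow_of_nonneg (by positivity) (by positivity)]
      _ = _ := by
          congr 1
          have h6 : (2 * (3 * CΓ * r)) ^ t = (6 * CΓ) ^ t * r ^ t := by
            rw [← Real.mul_rpow (by positivity) hrj.le]; ring_nf
          have hp1 : p * (1 / p) = 1 := by field_simp
          have h8 : ((2 * a) ^ p) ^ (1 / p) = 2 * a := by
            rw [← Real.rpow_mul (by positivity), hp1, Real.rpow_one]
          have h9 : (AΓ * ((6 * CΓ) ^ t * r ^ t)) ^ (1 / p) =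
              AΓ ^ (1 / p) * ((6 * CΓ) ^ (t / p) * r ^ (t / p)) := by
            rw [Real.mul_rpow (by positivity) (by positivity),
              Real.mul_rpow (by positivity) (by positivity),
              ← Real.rpow_mul (by positivity), ← Real.rpow_mul hrj.le, mul_one_div]
          rw [h6, Real.mul_rpow (by positivity) (by positivity),
            Real.mul_rpow (by positivity) V0, h8, h9, ha]
          have h7 : r ^ (-ω / p) * r ^ (t / p) = ρ ^ κ * (η ^ κ) ^ j := by
            rw [← Real.rpow_add hrj, hr]
            have : -ω / p + t / p = κ := by rw [hκ]; ring
            rw [this, Real.mul_rpow (by positivity) hρ0.le, ← Real.rpow_natCast, ← Real.rpow_mul ηpos.le,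
              ← Real.rpow_natCast, ← Real.rpow_mul ηpos.le, mul_comm (j : ℝ)]
            ring
          linear_combination (2 * cTwo n p CΓ ω * E * AΓ ^ (1 / p) * (6 * CΓ) ^ (t / p) *
            V ^ (1 / p)) * h7
  have hηκ : η ^ κ < 1 := Real.rpow_lt_one ηpos.le (by linarith) κ0
  have hηκ0 : 0 ≤ η ^ κ := by positivity
  have hρκ : ρ ^ κ ≤ η ^ ((k : ℝ) * (t - ω) / p) := by
    have : η ^ ((k : ℝ) * (t - ω) / p) = (η ^ k) ^ κ := by
      rw [← Real.rpow_natCast, ← Real.rpow_mul ηpos.le, hκ]; ring_nf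
    rw [this]
    apply Real.rpow_le_rpow hρ0.le _ κ0.le
    have h1 : ρ ≤ 3 * CΓ * ρ := by nlinarith
    have h2 : η ^ k * δΓ ≤ η ^ k := mul_le_of_le_one_right (by positivity) hδΓ1.le
    linarith
  calc _ ≤ (∫⁻ xb in G, (∑' j, f j xb) ^ p ∂μH[t]) ^ (1 / p) := by
        apply ENNReal.rpow_le_rpow _ (by positivity)
        exact setLIntegral_mono' hGm hpt
    _ ≤ ∑' j, (∫⁻ xb in G, f j xb ^ p ∂μH[t]) ^ (1 / p) := mink hfm hp
    _ ≤ ∑' j : ℕ, ENNReal.ofReal ((2 * cTwo n p CΓ ω * AΓ ^ (1 / p) * (6 * CΓ) ^ (t / p)) * E *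
        ρ ^ κ * V ^ (1 / p) * (η ^ κ) ^ j) := ENNReal.tsum_le_tsum hterm
    _ = ENNReal.ofReal ((2 * cTwo n p CΓ ω * AΓ ^ (1 / p) * (6 * CΓ) ^ (t / p)) * E *
        ρ ^ κ * V ^ (1 / p) * (1 - η ^ κ)⁻¹) := by
        rw [← ENNReal.ofReal_tsum_of_nonneg (fun j => by positivity)
          ((summable_geometric_of_lt_one hηκ0 hηκ).mul_left _), tsum_mul_left,
          tsum_geometric_of_lt_one hηκ0 hηκ]
    _ ≤ _ := by
        apply ENNReal.ofReal_le_ofReal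
        have h1 : 0 < (1 - η ^ κ)⁻¹ := inv_pos.2 (by linarith)
        calc _ = (2 * cTwo n p CΓ ω * AΓ ^ (1 / p) * (6 * CΓ) ^ (t / p)) * E *
              (1 - η ^ κ)⁻¹ * ρ ^ κ * V ^ (1 / p) := by ring
          _ ≤ _ := by gcongr
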